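/- Suppose q ≡ 7 (mod 8). Then for every irreducible complex character χ of G with χ(1) = (q−1)/2, Γ(χ) = m/2. -/

import Mathlib

open scoped BigOperators Classical

noncomputable section

/-- The projective special linear group `PSL(2, F) = SL(2, F)/{±I}` (for `F` a finite
field of odd characteristic the center of `SL(2,F)` is exactly `{±I}`). -/
abbrev PSL2 (F : Type) [Field F] : Type :=
  Matrix.SpecialLinearGroup (Fin 2) F ⧸ Subgroup.center (Matrix.SpecialLinearGroup (Fin 2) F)

/-- `χ` is the character of some finite-dimensional complex representation of `G`. -/
def IsCharacter (G : Type) [Group G] (χ : G → ℂ) : Prop :=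
  ∃ V : FDRep ℂ G, V.character = χ

/-- `χ` is an irreducible complex character of `G`. -/
def IsIrrCharacter (G : Type) [Group G] (χ : G → ℂ) : Prop :=
  ∃ V : FDRep ℂ G, CategoryTheory.Simple V ∧ V.character = χ

/-- `⟨χ|_H, θ⟩ = (1/|H|) ∑_{h ∈ H} χ(h) θ(h)⁻¹`, the multiplicity of the linear
character `θ` of `H` in the restriction `χ|_H`. -/
def restMult {G : Type} [Group G] [Finite G] (H : Subgroup G) (θ : H →* ℂˣ) (χ : G → ℂ) : ℂ :=
  letI : Fintype H := Fintype.ofFinite H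
  (Nat.card H : ℂ)⁻¹ * ∑ h : H, χ h * ((θ h : ℂ))⁻¹

/-- `dim χ^H = (1/|H|) ∑_{h ∈ H} χ(h)`, the dimension of the `H`-fixed subspace. -/
def dimFixed {G : Type} [Group G] [Finite G] (H : Subgroup G) (χ : G → ℂ) : ℂ :=
  letI : Fintype H := Fintype.ofFinite H
  (Nat.card H : ℂ)⁻¹ * ∑ h : H, χ h

/-- The ramification multiplicity
`Γ(χ) = (1/2)⟨χ|_{H₂},θ₂⟩ + (1/3)(⟨χ|_{H₃},θ₃⟩ + 2⟨χ|_{H₃},θ₃²⟩)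
  + (1/7)∑_{k=1}^{6} k ⟨χ|_{H₇},θ₇^k⟩`. -/
def ramMult {G : Type} [Group G] [Finite G] (H2 H3 H7 : Subgroup G)
    (θ2 : H2 →* ℂˣ) (θ3 : H3 →* ℂˣ) (θ7 : H7 →* ℂˣ) (χ : G → ℂ) : ℂ :=
  (1/2) * restMult H2 θ2 χ
    + (1/3) * (restMult H3 θ3 χ + 2 * restMult H3 (θ3 ^ 2) χ)
    + (1/7) * ∑ k ∈ Finset.Icc (1:ℕ) 6, (k : ℂ) * restMult H7 (θ7 ^ k) χ

/-- The base multiplicity `m = (q−ε₂)/4 + (q−ε₃)/3 + 3(q−ε₇)/7`, where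
`ε_ℓ = 1` if `q ≡ 1 (mod ℓ')` and `ε_ℓ = −1` otherwise. -/
def baseMult (q : ℕ) : ℤ :=
  ((q : ℤ) - (if q % 4 = 1 then 1 else -1)) / 4
    + ((q : ℤ) - (if q % 3 = 1 then 1 else -1)) / 3
    + 3 * (((q : ℤ) - (if q % 7 = 1 then 1 else -1)) / 7)

/-- The character of a representation of a finite abelian group is a combination of linear
characters with natural number coefficients. -/
lemma exists_character_eq_sum_addChar {A W : Type*} [AddCommGroup A] [Fintype A]
    [AddCommGroup W] [Module ℂ W] [FiniteDimensional ℂ W]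
    (ρ : Representation ℂ (Multiplicative A) W) :
    ∃ m : AddChar A ℂ → ℕ, ∀ a : A,
      ρ.character (Multiplicative.ofAdd a) = ∑ ψ : AddChar A ℂ, (m ψ : ℂ) * ψ a := by
  have hcard : (Fintype.card A : ℂ) ≠ 0 := by exact_mod_cast Fintype.card_ne_zero
  let σ : AddChar A ℂ → Representation ℂ (Multiplicative A) W := fun ψ =>
    { toFun := fun g => ψ (-(Multiplicative.toAdd g)) • ρ g
      map_one' := by simp
      map_mul' := fun g h => by
        ext w
        simp [AddChar.map_add_eq_mul, smul_smul, mul_comm] }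
  have hσ : ∀ ψ b, (σ ψ).character (Multiplicative.ofAdd b)
      = ψ (-b) * ρ.character (Multiplicative.ofAdd b) := by
    intro ψ b
    change LinearMap.trace ℂ W (ψ (-b) • ρ (Multiplicative.ofAdd b)) = _
    rw [map_smul, smul_eq_mul]
    rfl
  refine ⟨fun ψ => Module.finrank ℂ (σ ψ).invariants, fun a => ?_⟩
  have hN : (Nat.card (Multiplicative A) : ℂ) = Fintype.card A := by
    rw [Nat.card_eq_fintype_card, Fintype.card_multiplicative]
  let _ : Invertible (Nat.card (Multiplicative A) : ℂ) := invertibleOfNonzero (by rw [hN]; exact hcard)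
  have hm : ∀ ψ, (Module.finrank ℂ (σ ψ).invariants : ℂ)
      = (Fintype.card A : ℂ)⁻¹ * ∑ b : A, ψ (-b) * ρ.character (Multiplicative.ofAdd b) := by
    intro ψ
    rw [← Representation.card_inv_mul_sum_char_eq_finrank, hN]
    congr 1
    exact (Fintype.sum_equiv Multiplicative.ofAdd _ _ fun b => (hσ ψ b).symm).symm
  simp_rw [hm, mul_assoc, ← Finset.mul_sum, Finset.sum_mul]
  rw [Finset.sum_comm]
  have : ∀ b : A, ∑ ψ : AddChar A ℂ, ψ (-b) * ρ.character (Multiplicative.ofAdd b) * ψ a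
      = if b = a then (Fintype.card A : ℂ) * ρ.character (Multiplicative.ofAdd b) else 0 := by
    intro b
    have h := AddChar.sum_apply_eq_ite (a - b)
    simp only [sub_eq_zero] at h
    calc _ = (∑ ψ : AddChar A ℂ, ψ (a - b)) * ρ.character (Multiplicative.ofAdd b) := by
          rw [Finset.sum_mul]
          refine Finset.sum_congr rfl fun ψ _ => ?_
          rw [sub_eq_add_neg, AddChar.map_add_eq_mul]
          ring
      _ = _ := by
          rw [h]
          by_cases hb : b = a
          · simp [hb]
          · simp [hb, Ne.symm hb]
  simp_rw [this]
  simp [hcard]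

/-- Parseval's identity for a combination of linear characters. -/
lemma sum_normSq_sum_addChar {A : Type*} [AddCommGroup A] [Fintype A] (m : AddChar A ℂ → ℕ) :
    ∑ a : A, Complex.normSq (∑ ψ : AddChar A ℂ, (m ψ : ℂ) * ψ a)
      = Fintype.card A * ∑ ψ : AddChar A ℂ, (m ψ : ℝ) ^ 2 := by
  have key : ∀ ψ φ : AddChar A ℂ, ∑ a : A, φ (-a) * ψ a
      = if φ = ψ then (Fintype.card A : ℂ) else 0 := by
    intro ψ φ
    have h := AddChar.sum_eq_ite (φ⁻¹ * ψ)
    simp only [AddChar.mul_apply, AddChar.inv_apply] at h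
    rw [h]
    congr 1
    rw [← AddChar.one_eq_zero, inv_mul_eq_one]
  apply Complex.ofReal_injective
  push_cast
  simp_rw [Complex.normSq_eq_conj_mul_self, map_sum, map_mul, Complex.conj_natCast,
    ← AddChar.map_neg_eq_conj, Finset.sum_mul_sum]
  rw [Finset.sum_comm, Finset.mul_sum]
  refine Finset.sum_congr rfl fun φ _ => ?_
  rw [Finset.sum_comm]
  calc _ = ∑ ψ : AddChar A ℂ, (m φ * m ψ : ℂ) * ∑ a : A, φ (-a) * ψ a := by
        refine Finset.sum_congr rfl fun ψ _ => ?_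
        rw [Finset.mul_sum]
        exact Finset.sum_congr rfl fun a _ => by ring
    _ = _ := by
        simp_rw [key]
        simp
        ring

section FiniteGroup

open scoped IsMulCommutative

variable {G W : Type*} [Group G] [Fintype G] [AddCommGroup W] [Module ℂ W]
  [FiniteDimensional ℂ W]

/-- Restriction of a character to a commutative subgroup, as a combination of linear characters. -/
lemma exists_character_subgroup_eq_sum (ρ : Representation ℂ G W) (K : Subgroup G)
    [IsMulCommutative K] :
    ∃ m : AddChar (Additive K) ℂ → ℕ, ∀ k : K,
      ρ.character k = ∑ ψ : AddChar (Additive K) ℂ, (m ψ : ℂ) * ψ (Additive.ofMul k) := by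
  obtain ⟨m, hm⟩ := exists_character_eq_sum_addChar (A := Additive K)
    (ρ.comp (K.subtype.comp (MulEquiv.refl (Multiplicative (Additive K))).toMonoidHom))
  exact ⟨m, fun k => hm (Additive.ofMul k)⟩

lemma character_inv_eq_conj (ρ : Representation ℂ G W) (g : G) :
    ρ.character g⁻¹ = (starRingEnd ℂ) (ρ.character g) := by
  obtain ⟨m, hm⟩ := exists_character_subgroup_eq_sum ρ (Subgroup.zpowers g)
  have h1 := hm ⟨g, Subgroup.mem_zpowers g⟩
  have h2 := hm ⟨g, Subgroup.mem_zpowers g⟩⁻¹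
  simp only [InvMemClass.coe_inv] at h1 h2
  rw [h1, h2, map_sum]
  refine Finset.sum_congr rfl fun ψ _ => ?_
  rw [map_mul, Complex.conj_natCast, ofMul_inv, AddChar.map_neg_eq_conj]

/-- The degree and the norm of the restriction of a character to a commutative subgroup, in terms
of the multiplicities of the linear characters. -/
lemma exists_mult_finrank_sum_normSq (ρ : Representation ℂ G W) (K : Subgroup G)
    [IsMulCommutative K] :
    ∃ m : AddChar (Additive K) ℂ → ℕ,
      (∀ k : K, ρ.character k = ∑ ψ : AddChar (Additive K) ℂ, (m ψ : ℂ) * ψ (Additive.ofMul k)) ∧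
      Module.finrank ℂ W = ∑ ψ, m ψ ∧
      ∑ k : K, Complex.normSq (ρ.character k) = Nat.card K * ∑ ψ, (m ψ : ℝ) ^ 2 := by
  obtain ⟨m, hm⟩ := exists_character_subgroup_eq_sum ρ K
  refine ⟨m, hm, ?_, ?_⟩
  · have := hm 1
    simp only [OneMemClass.coe_one, Representation.char_one, ofMul_one, AddChar.map_zero_eq_one,
      mul_one] at this
    exact_mod_cast this
  · have := sum_normSq_sum_addChar m
    rw [Fintype.card_additive, ← Nat.card_eq_fintype_card] at this
    rw [← this]
    exact Fintype.sum_equiv Additive.ofMul _ _ fun k => by rw [hm]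

lemma card_mul_finrank_le_sum_normSq (ρ : Representation ℂ G W) (K : Subgroup G)
    [IsMulCommutative K] :
    (Nat.card K * Module.finrank ℂ W : ℝ) ≤ ∑ k : K, Complex.normSq (ρ.character k) := by
  obtain ⟨m, -, hd, h⟩ := exists_mult_finrank_sum_normSq ρ K
  rw [h, hd]
  push_cast
  gcongr with ψ
  exact_mod_cast Nat.le_self_pow two_ne_zero _

/-- If the norm of a character of degree `|K| - 1` of an abelian group `K` is as small as possible,
then the character is the regular one minus a linear character. -/
lemma exists_linear_of_sum_normSq_le (ρ : Representation ℂ G W) (K : Subgroup G)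
    [IsMulCommutative K] (hd : Nat.card K = Module.finrank ℂ W + 1)
    (h : ∑ k : K, Complex.normSq (ρ.character k) ≤ Nat.card K * Module.finrank ℂ W) :
    ∃ l : K →* ℂ, ∀ k : K, k ≠ 1 → ρ.character k = - l k := by
  obtain ⟨m, hm, hfr, hs⟩ := exists_mult_finrank_sum_normSq ρ K
  rw [hs, hfr] at h
  have hpos : (0 : ℝ) < Nat.card K := by exact_mod_cast Nat.card_pos
  have h' := le_of_mul_le_mul_left h hpos
  have h2 : ∑ ψ, m ψ ^ 2 ≤ ∑ ψ, m ψ := by exact_mod_cast h'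
  have hle : ∀ ψ ∈ (Finset.univ : Finset (AddChar (Additive K) ℂ)), m ψ ≤ m ψ ^ 2 :=
    fun ψ _ => Nat.le_self_pow two_ne_zero _
  have heq := (Finset.sum_eq_sum_iff_of_le hle).1 (le_antisymm (Finset.sum_le_sum hle) h2)
  have h01 : ∀ ψ, m ψ = 0 ∨ m ψ = 1 := by
    intro ψ
    have := heq ψ (Finset.mem_univ _)
    rcases Nat.eq_zero_or_pos (m ψ) with h0 | h0
    · exact Or.inl h0
    · right; nlinarith
  have hcard : ∑ ψ : AddChar (Additive K) ℂ, (1 - m ψ) = 1 := by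
    have e1 : ∑ ψ : AddChar (Additive K) ℂ, (1 - m ψ) + ∑ ψ, m ψ
        = Fintype.card (AddChar (Additive K) ℂ) := by
      rw [← Finset.sum_add_distrib, Fintype.card_eq_sum_ones]
      refine Finset.sum_congr rfl fun ψ _ => ?_
      rcases h01 ψ with h | h <;> simp [h]
    rw [AddChar.card_eq, Fintype.card_additive, ← Nat.card_eq_fintype_card, hd, hfr] at e1
    omega
  obtain ⟨l, -, hl1⟩ : ∃ l ∈ (Finset.univ : Finset (AddChar (Additive K) ℂ)), 1 - m l ≠ 0 := by
    apply Finset.exists_ne_zero_of_sum_ne_zero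
    rw [hcard]; exact one_ne_zero
  have hl0 : m l = 0 := by rcases h01 l with h | h <;> omega
  have hother : ∀ ψ, ψ ≠ l → m ψ = 1 := by
    intro ψ hψ
    have := Finset.add_sum_erase Finset.univ (fun ψ => 1 - m ψ) (Finset.mem_univ l)
    have h3 : ∑ ψ ∈ Finset.univ.erase l, (1 - m ψ) = 0 := by
      simp only [hcard, hl0] at this; omega
    have := (Finset.sum_eq_zero_iff.1 h3) ψ (by simp [hψ])
    rcases h01 ψ with h | h <;> omega
  refine ⟨⟨⟨fun k => l (Additive.ofMul k), by simp⟩,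
    fun a b => by simp [AddChar.map_add_eq_mul]⟩, fun k hk => ?_⟩
  change _ = - l (Additive.ofMul k)
  have hsum := AddChar.sum_apply_eq_ite (Additive.ofMul k)
  rw [if_neg (by simpa using hk)] at hsum
  rw [hm, ← sub_eq_zero, sub_neg_eq_add, ← hsum,
    ← Finset.add_sum_erase _ _ (Finset.mem_univ l), ← Finset.add_sum_erase _ _ (Finset.mem_univ l),
    hl0, add_comm]
  simp only [Nat.cast_zero, zero_mul, zero_add]
  congr 1
  refine Finset.sum_congr rfl fun ψ hψ => ?_
  rw [hother ψ (Finset.ne_of_mem_erase hψ)]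
  simp

/-- If `N` contains every `x` with `x K x⁻¹ ∩ K ≠ 1`, then the sum of a nonnegative class function
over the nontrivial conjugates of elements of `K` is at least `|G| / |N|` times that over `K`. -/
lemma card_mul_sum_subgroup_le (F : G → ℝ) (hF : ∀ g, 0 ≤ F g)
    (hconj : ∀ x g, F (x * g * x⁻¹) = F g) (K : Subgroup G) (N : Finset G)
    (hN : ∀ x, ∀ k ∈ K, k ≠ 1 → x * k * x⁻¹ ∈ K → x ∈ N) :
    Fintype.card G * (∑ k : K, F k - F 1)
      ≤ N.card * ∑ g with g ≠ 1 ∧ ∃ x, x⁻¹ * g * x ∈ K, F g := by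
  have h1 : ∑ k : K, F k - F 1 = ∑ g with g ≠ 1 ∧ g ∈ K, F g := by
    rw [show ∑ k : K, F k = ∑ g with g ∈ K, F g from
      (Finset.sum_subtype _ (by simp) F).symm,
      ← Finset.sum_filter_add_sum_filter_not (Finset.univ.filter (· ∈ K)) (fun g => g = 1),
      Finset.filter_filter, Finset.filter_filter,
      show (Finset.univ.filter fun g => g ∈ K ∧ g = 1) = {1} by
        ext g; simp only [Finset.mem_filter, Finset.mem_univ, true_and, Finset.mem_singleton]
        exact ⟨fun h => h.2, fun h => ⟨h ▸ K.one_mem, h⟩⟩]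
    simp [and_comm]
  have h2 : ∀ x : G, ∑ g with g ≠ 1 ∧ g ∈ K, F g
      = ∑ g : G, if g ≠ 1 ∧ x⁻¹ * g * x ∈ K then F g else 0 := by
    intro x
    rw [Finset.sum_filter]
    refine Fintype.sum_equiv (MulAut.conj x).toEquiv _ _ fun g => ?_
    have : x⁻¹ * (x * g * x⁻¹) * x = g := by group
    simp [hconj, this]
  calc Fintype.card G * (∑ k : K, F k - F 1)
      = ∑ x : G, ∑ g : G, if g ≠ 1 ∧ x⁻¹ * g * x ∈ K then F g else 0 := by
        rw [← Finset.sum_congr rfl fun x _ => h2 x, h1]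
        simp
    _ = ∑ g : G, (Finset.univ.filter fun x => g ≠ 1 ∧ x⁻¹ * g * x ∈ K).card * F g := by
        rw [Finset.sum_comm]
        refine Finset.sum_congr rfl fun g _ => ?_
        rw [← Finset.sum_filter]
        simp
    _ ≤ ∑ g : G, if g ≠ 1 ∧ ∃ x, x⁻¹ * g * x ∈ K then N.card * F g else 0 := by
        refine Finset.sum_le_sum fun g _ => ?_
        split_ifs with h
        · obtain ⟨hg, y, hy⟩ := h
          refine mul_le_mul_of_nonneg_right ?_ (hF g)
          norm_cast
          refine Finset.card_le_card_of_injOn (fun x => x⁻¹ * y) (fun x hx => ?_)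
            (fun a _ b _ hab => by simpa using hab)
          simp only [Finset.coe_filter, Finset.mem_univ, true_and, Set.mem_ofPred_eq] at hx
          refine hN _ (y⁻¹ * g * y) hy (fun h => hg ?_) ?_
          · have : g = y * (y⁻¹ * g * y) * y⁻¹ := by group
            rw [this, h]; group
          · have : x⁻¹ * y * (y⁻¹ * g * y) * (x⁻¹ * y)⁻¹ = x⁻¹ * g * x := by group
            rw [this]; exact hx.2
        · rw [Finset.card_eq_zero.2]
          · simp
          · ext x
            simp only [Finset.mem_filter, Finset.mem_univ, true_and, Finset.notMem_empty,
              iff_false]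
            exact fun hx => h ⟨hx.1, x, hx.2⟩
    _ = _ := by rw [← Finset.sum_filter, Finset.mul_sum]

/-- In a finite group with the numerology of `PSL(2, q)`, `q = 2d + 1`, the restriction of an
irreducible character of degree `d` to a nonsplit torus `K` has minimal norm, and the character
vanishes at the elements that are conjugate neither to `K` nor to the unipotent subgroup `U`. -/
lemma sum_normSq_le_and_character_eq_zero (ρ : Representation ℂ G W)
    (htot : ∑ g : G, Complex.normSq (ρ.character g) = Fintype.card G)
    (K U : Subgroup G) [IsMulCommutative K] [IsMulCommutative U] (NK NU : Finset G)
    (hNK : ∀ x, ∀ k ∈ K, k ≠ 1 → x * k * x⁻¹ ∈ K → x ∈ NK)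
    (hNU : ∀ x, ∀ k ∈ U, k ≠ 1 → x * k * x⁻¹ ∈ U → x ∈ NU)
    (hKU : ∀ x, ∀ k ∈ K, k ≠ 1 → x * k * x⁻¹ ∉ U)
    (d : ℕ) (hd : Module.finrank ℂ W = d) (hd0 : 0 < d)
    (hG : Fintype.card G = 2 * d * (d + 1) * (2 * d + 1))
    (hK : Nat.card K = d + 1) (hU : Nat.card U = 2 * d + 1)
    (hNKc : NK.card ≤ 2 * (d + 1)) (hNUc : NU.card ≤ d * (2 * d + 1)) :
    ∑ k : K, Complex.normSq (ρ.character k) ≤ Nat.card K * d ∧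
    ∀ g, (∀ x, x⁻¹ * g * x ∉ K) → (∀ x, x⁻¹ * g * x ∉ U) → ρ.character g = 0 := by
  set F : G → ℝ := fun g => Complex.normSq (ρ.character g) with hFdef
  have hF : ∀ g, 0 ≤ F g := fun g => Complex.normSq_nonneg _
  have hconj : ∀ x g, F (x * g * x⁻¹) = F g := fun x g => by simp [F]
  have hF1 : F 1 = d ^ 2 := by
    simp [F, hd, Complex.normSq_apply, sq]
  change ∑ g : G, F g = Fintype.card G at htot
  have hcK := card_mul_sum_subgroup_le F hF hconj K NK hNK
  have hcU := card_mul_sum_subgroup_le F hF hconj U NU hNU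
  set SK := Finset.univ.filter fun g => g ≠ 1 ∧ ∃ x, x⁻¹ * g * x ∈ K with hSK
  set SU := Finset.univ.filter fun g => g ≠ 1 ∧ ∃ x, x⁻¹ * g * x ∈ U with hSU
  have hlK := card_mul_finrank_le_sum_normSq ρ K
  have hlU := card_mul_finrank_le_sum_normSq ρ U
  change _ ≤ ∑ k : K, F k at hlK
  change _ ≤ ∑ k : U, F k at hlU
  change ∑ k : K, F k ≤ _ ∧ _
  rw [hd, hK] at hlK
  rw [hd, hU] at hlU
  rw [hF1, hG] at hcK hcU
  rw [hK]
  have hdisj : Disjoint SK SU := by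
    rw [Finset.disjoint_left]
    intro g hg hg'
    simp only [hSK, hSU, Finset.mem_filter, Finset.mem_univ, true_and] at hg hg'
    obtain ⟨hg1, x, hx⟩ := hg
    obtain ⟨-, y, hy⟩ := hg'
    refine hKU (y⁻¹ * x) _ hx (fun h => hg1 ?_) ?_
    · have : g = x * (x⁻¹ * g * x) * x⁻¹ := by group
      rw [this, h]; group
    · have : y⁻¹ * x * (x⁻¹ * g * x) * (y⁻¹ * x)⁻¹ = y⁻¹ * g * y := by group
      rwa [this]
  have hdisj1 : Disjoint {1} (SK ∪ SU) := by simp [hSK, hSU]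
  have hrest : d ^ 2 + (∑ g ∈ SK, F g + ∑ g ∈ SU, F g)
      + ∑ g ∈ ({1} ∪ (SK ∪ SU))ᶜ, F g = 2 * d * (d + 1) * (2 * d + 1) := by
    have := Finset.sum_add_sum_compl ({1} ∪ (SK ∪ SU)) F
    rw [Finset.sum_union hdisj1, Finset.sum_union hdisj, htot, hG, Finset.sum_singleton, hF1] at this
    rw [this]; push_cast; ring
  have hSK0 : 0 ≤ ∑ g ∈ SK, F g := Finset.sum_nonneg fun g _ => hF g
  have hSU0 : 0 ≤ ∑ g ∈ SU, F g := Finset.sum_nonneg fun g _ => hF g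
  have hR0 : 0 ≤ ∑ g ∈ ({1} ∪ (SK ∪ SU))ᶜ, F g := Finset.sum_nonneg fun g _ => hF g
  have hdpos : (0 : ℝ) < d := by exact_mod_cast hd0
  have hNKc' : (NK.card : ℝ) ≤ 2 * (d + 1) := by exact_mod_cast hNKc
  have hNUc' : (NU.card : ℝ) ≤ d * (2 * d + 1) := by exact_mod_cast hNUc
  push_cast at hcK hcU hlK hlU
  have e1 : d * (2 * d + 1) * (∑ k : K, F k - d ^ 2) ≤ ∑ g ∈ SK, F g := by
    have := hcK.trans (mul_le_mul_of_nonneg_right hNKc' hSK0)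
    have hp : (0 : ℝ) < 2 * (d + 1) := by positivity
    refine le_of_mul_le_mul_left ?_ hp
    linarith
  have e2 : 2 * (d + 1) * (∑ k : U, F k - d ^ 2) ≤ ∑ g ∈ SU, F g := by
    have := hcU.trans (mul_le_mul_of_nonneg_right hNUc' hSU0)
    have hp : (0 : ℝ) < d * (2 * d + 1) := by positivity
    refine le_of_mul_le_mul_left ?_ hp
    linarith
  have e3 : 2 * (d + 1) * ((2 * d + 1) * d - d ^ 2 : ℝ) ≤ ∑ g ∈ SU, F g :=
    le_trans (mul_le_mul_of_nonneg_left (by linarith) (by positivity)) e2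
  have e4 : d * (2 * d + 1) * ((d + 1) * d - d ^ 2 : ℝ) ≤ ∑ g ∈ SK, F g :=
    le_trans (mul_le_mul_of_nonneg_left (by linarith) (by positivity)) e1
  constructor
  · have hp : (0 : ℝ) < d * (2 * d + 1) := by positivity
    refine le_of_mul_le_mul_left ?_ hp
    push_cast
    linarith
  · intro g hgK hgU
    have hR : ∑ g ∈ ({1} ∪ (SK ∪ SU))ᶜ, F g = 0 := by
      refine le_antisymm ?_ hR0
      linarith
    have hg : g ∈ ({1} ∪ (SK ∪ SU))ᶜ := by
      have h1 : g ≠ 1 := fun h => hgK 1 (by simp [h, K.one_mem])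
      simp [hSK, hSU, h1]
      exact ⟨hgK, hgU⟩
    have := (Finset.sum_eq_zero_iff_of_nonneg fun g _ => hF g).1 hR g hg
    exact Complex.normSq_eq_zero.1 this

lemma sum_normSq_character {G : Type} [Group G] [Fintype G] (V : FDRep ℂ G)
    [CategoryTheory.Simple V] :
    ∑ g : G, Complex.normSq (Representation.character V.ρ g) = Fintype.card G := by
  have hc : (Nat.card G : ℂ) ≠ 0 := by exact_mod_cast Nat.card_pos.ne'
  let _ : Invertible (Nat.card G : ℂ) := invertibleOfNonzero hc
  have h := FDRep.char_orthonormal V V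
  rw [if_pos ⟨CategoryTheory.Iso.refl V⟩, inv_mul_eq_iff_eq_mul₀ hc, mul_one,
    Nat.card_eq_fintype_card] at h
  apply Complex.ofReal_injective
  push_cast
  rw [← h]
  refine Finset.sum_congr rfl fun g _ => ?_
  change _ = Representation.character V.ρ g * Representation.character V.ρ g⁻¹
  rw [character_inv_eq_conj, Complex.mul_conj]

end FiniteGroup

section Matrices

variable {F : Type} [Field F]

local notation "SLtwo" => Matrix.SpecialLinearGroup (Fin 2) F

lemma sl2_ext {A B : SLtwo} (h00 : A 0 0 = B 0 0) (h01 : A 0 1 = B 0 1) (h10 : A 1 0 = B 1 0)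
    (h11 : A 1 1 = B 1 1) : A = B := by
  ext i j
  fin_cases i <;> fin_cases j <;> assumption

lemma sl2_mul_apply (A B : SLtwo) (i j : Fin 2) :
    (A * B) i j = A i 0 * B 0 j + A i 1 * B 1 j := by
  simp [Matrix.mul_apply, Fin.sum_univ_two]

lemma sl2_det (A : SLtwo) : A 0 0 * A 1 1 - A 0 1 * A 1 0 = 1 := by
  rw [← Matrix.det_fin_two, A.det_coe]

lemma sl2_inv_apply (A : SLtwo) :
    A⁻¹ 0 0 = A 1 1 ∧ A⁻¹ 0 1 = - A 0 1 ∧ A⁻¹ 1 0 = - A 1 0 ∧ A⁻¹ 1 1 = A 0 0 := by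
  simp [Matrix.adjugate_fin_two]

/-- The matrix with given entries and determinant one. -/
def sl2Mk (a b c d : F) (h : a * d - b * c = 1) : SLtwo :=
  ⟨!![a, b; c, d], by rw [Matrix.det_fin_two_of, h]⟩

@[simp] lemma sl2Mk_apply (a b c d : F) (h : a * d - b * c = 1) :
    sl2Mk a b c d h 0 0 = a ∧ sl2Mk a b c d h 0 1 = b ∧ sl2Mk a b c d h 1 0 = c ∧
      sl2Mk a b c d h 1 1 = d := by
  simp [sl2Mk]

lemma mem_center_sl2_iff {A : SLtwo} : A ∈ Subgroup.center SLtwo ↔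
    A 0 1 = 0 ∧ A 1 0 = 0 ∧ A 0 0 = A 1 1 := by
  rw [Matrix.SpecialLinearGroup.mem_center_iff]
  constructor
  · rintro ⟨r, -, hr⟩
    have h : ∀ i j, A i j = Matrix.scalar (Fin 2) r i j := fun i j => by rw [hr]
    simp [h]
  · rintro ⟨h1, h2, h3⟩
    have := sl2_det A
    refine ⟨A 0 0, ?_, ?_⟩
    · simp only [Fintype.card_fin]
      linear_combination this + A 0 0 * h3 + h1 * A 1 0
    · ext i j
      fin_cases i <;> fin_cases j <;> simp [h1, h2, h3]

/-- The subgroup of upper triangular matrices. -/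
def upperTri (F : Type) [Field F] : Subgroup (Matrix.SpecialLinearGroup (Fin 2) F) where
  carrier := {A | A 1 0 = 0}
  one_mem' := by simp
  mul_mem' {A B} hA hB := by
    simp only [Set.mem_ofPred_eq] at *
    rw [sl2_mul_apply, hA, hB]; ring
  inv_mem' {A} hA := by
    simp only [Set.mem_ofPred_eq] at *
    rw [(sl2_inv_apply A).2.2.1, hA, neg_zero]

/-- The subgroup of upper triangular matrices with equal diagonal entries. -/
def unip (F : Type) [Field F] : Subgroup (Matrix.SpecialLinearGroup (Fin 2) F) where
  carrier := {A | A 1 0 = 0 ∧ A 0 0 = A 1 1}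
  one_mem' := by simp
  mul_mem' {A B} hA hB := by
    simp only [Set.mem_ofPred_eq, sl2_mul_apply] at *
    rw [hA.1, hB.1, hA.2, hB.2]
    constructor <;> ring
  inv_mem' {A} hA := by
    obtain ⟨h1, h2, h3, h4⟩ := sl2_inv_apply A
    simp only [Set.mem_ofPred_eq] at *
    rw [h1, h3, h4, hA.1, hA.2]
    simp

/-- The special orthogonal group of the form `x² + y²`. -/
def circ (F : Type) [Field F] : Subgroup (Matrix.SpecialLinearGroup (Fin 2) F) where
  carrier := {A | A 1 0 = - A 0 1 ∧ A 0 0 = A 1 1}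
  one_mem' := by simp
  mul_mem' {A B} hA hB := by
    simp only [Set.mem_ofPred_eq, sl2_mul_apply] at *
    rw [hA.1, hB.1, hA.2, hB.2]
    constructor <;> ring
  inv_mem' {A} hA := by
    obtain ⟨h1, h2, h3, h4⟩ := sl2_inv_apply A
    simp only [Set.mem_ofPred_eq] at *
    rw [h1, h2, h3, h4, hA.1, hA.2]
    simp

lemma mem_upperTri {A : SLtwo} : A ∈ upperTri F ↔ A 1 0 = 0 := Iff.rfl

lemma mem_unip {A : SLtwo} : A ∈ unip F ↔ A 1 0 = 0 ∧ A 0 0 = A 1 1 := Iff.rfl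

lemma mem_circ {A : SLtwo} : A ∈ circ F ↔ A 1 0 = - A 0 1 ∧ A 0 0 = A 1 1 := Iff.rfl

lemma center_le_upperTri : Subgroup.center SLtwo ≤ upperTri F := fun _ hA =>
  (mem_center_sl2_iff.1 hA).2.1

lemma center_le_unip : Subgroup.center SLtwo ≤ unip F := fun _ hA =>
  (mem_center_sl2_iff.1 hA).2

lemma center_le_circ : Subgroup.center SLtwo ≤ circ F := fun A hA => by
  obtain ⟨h1, h2, h3⟩ := mem_center_sl2_iff.1 hA
  exact ⟨by rw [h1, h2, neg_zero], h3⟩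

instance unip_isMulCommutative : IsMulCommutative (unip F) := by
  refine ⟨⟨fun ⟨A, hA⟩ ⟨B, hB⟩ => Subtype.ext ?_⟩⟩
  rw [mem_unip] at hA hB
  apply sl2_ext <;> simp only [Subgroup.coe_mul, sl2_mul_apply, hA, hB] <;> ring

instance circ_isMulCommutative : IsMulCommutative (circ F) := by
  refine ⟨⟨fun ⟨A, hA⟩ ⟨B, hB⟩ => Subtype.ext ?_⟩⟩
  rw [mem_circ] at hA hB
  apply sl2_ext <;> simp only [Subgroup.coe_mul, sl2_mul_apply, hA, hB] <;> ring

lemma card_upperTri [Fintype F] :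
    Nat.card (upperTri F) = (Fintype.card F - 1) * Fintype.card F := by
  have e : upperTri F ≃ Fˣ × F :=
    { toFun := fun A => (⟨A.1 0 0, A.1 1 1,
          by have := sl2_det A.1; rw [mem_upperTri.1 A.2] at this; linear_combination this,
          by have := sl2_det A.1; rw [mem_upperTri.1 A.2] at this; linear_combination this⟩, A.1 0 1)
      invFun := fun p => ⟨sl2Mk p.1 p.2 0 ((p.1⁻¹ : Fˣ) : F) (by simp), by simp [mem_upperTri]⟩
      left_inv := fun A => by
        apply Subtype.ext
        apply sl2_ext <;> simp [mem_upperTri.1 A.2]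
      right_inv := fun p => by
        ext <;> simp }
  rw [Nat.card_congr e, Nat.card_prod, Nat.card_eq_fintype_card, Nat.card_eq_fintype_card,
    Fintype.card_units]

lemma card_sl2 [Fintype F] :
    Nat.card SLtwo
      = (Fintype.card F - 1) * Fintype.card F * (Fintype.card F + 1) := by
  have e : {A : SLtwo // ¬ A ∈ upperTri F} ≃ Fˣ × F × F :=
    { toFun := fun A => (Units.mk0 (A.1 1 0) fun h => A.2 h, A.1 0 0, A.1 1 1)
      invFun := fun p => ⟨sl2Mk p.2.1 ((p.2.1 * p.2.2 - 1) * ((p.1⁻¹ : Fˣ) : F)) p.1 p.2.2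
        (by simp), by simp [mem_upperTri]⟩
      left_inv := fun A => by
        have h0 : A.1 1 0 ≠ 0 := A.2
        have := sl2_det A.1
        apply Subtype.ext
        apply sl2_ext
        · simp
        · simp
          field_simp
          linear_combination this
        · simp
        · simp
      right_inv := fun p => by
        ext <;> simp }
  have h1 : Nat.card {A : SLtwo // A ∈ upperTri F} = _ := card_upperTri (F := F)
  rw [Nat.card_congr (Equiv.sumCompl fun A : SLtwo => A ∈ upperTri F).symm, Nat.card_sum, h1,
    Nat.card_congr e]
  rw [Nat.card_prod, Nat.card_prod, Nat.card_eq_fintype_card, Nat.card_eq_fintype_card,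
    Fintype.card_units]
  ring

lemma card_sq_eq_one (h2 : (2 : F) ≠ 0) : Nat.card {r : F // r ^ 2 = 1} = 2 := by
  have h : {r : F | r ^ 2 = 1} = {1, -1} := by
    ext r; simp
  change Nat.card ({r : F | r ^ 2 = 1} : Set F) = 2
  rw [h, Nat.card_coe_set_eq, Set.ncard_pair]
  intro h
  exact h2 (by linear_combination h)

lemma card_center (h2 : (2 : F) ≠ 0) : Nat.card (Subgroup.center SLtwo) = 2 := by
  refine Eq.trans (Nat.card_congr ?_) (card_sq_eq_one h2)
  exact
    { toFun := fun A => ⟨A.1 0 0, by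
        obtain ⟨h1, h2, h3⟩ := mem_center_sl2_iff.1 A.2
        have := sl2_det A.1
        linear_combination this + A.1 0 0 * h3 + h1 * A.1 1 0⟩
      invFun := fun r => ⟨sl2Mk r.1 0 0 r.1 (by linear_combination r.2),
        mem_center_sl2_iff.2 (by simp)⟩
      left_inv := fun A => by
        obtain ⟨h1, h2, h3⟩ := mem_center_sl2_iff.1 A.2
        apply Subtype.ext
        apply sl2_ext <;> simp [h1, h2, h3]
      right_inv := fun r => by simp }

lemma card_unip [Fintype F] (h2 : (2 : F) ≠ 0) :
    Nat.card (unip F) = 2 * Fintype.card F := by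
  refine Eq.trans (Nat.card_congr (β := {r : F // r ^ 2 = 1} × F) ?_)
    (by rw [Nat.card_prod, card_sq_eq_one h2, Nat.card_eq_fintype_card])
  exact
    { toFun := fun A => (⟨A.1 0 0, by
        obtain ⟨h1, h3⟩ := mem_unip.1 A.2
        have := sl2_det A.1
        linear_combination this + A.1 0 0 * h3 + A.1 0 1 * h1⟩, A.1 0 1)
      invFun := fun r => ⟨sl2Mk r.1.1 r.2 0 r.1.1 (by linear_combination r.1.2),
        mem_unip.2 (by simp)⟩
      left_inv := fun A => by
        obtain ⟨h1, h3⟩ := mem_unip.1 A.2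
        apply Subtype.ext
        apply sl2_ext <;> simp [h1, h3]
      right_inv := fun r => by simp }

lemma card_circ [Fintype F] (h2 : (2 : F) ≠ 0) (hs : ∀ t : F, 1 + t ^ 2 ≠ 0) :
    Nat.card (circ F) = Fintype.card F + 1 := by
  have hdet : ∀ t : F, (1 - t ^ 2) / (1 + t ^ 2) * ((1 - t ^ 2) / (1 + t ^ 2))
      - 2 * t / (1 + t ^ 2) * - (2 * t / (1 + t ^ 2)) = 1 := by
    intro t
    have := hs t
    field_simp
    ring
  let f : Option F → circ F := fun o => match o with
    | none => ⟨sl2Mk (-1) 0 0 (-1) (by ring), mem_circ.2 (by simp)⟩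
    | some t => ⟨sl2Mk _ _ _ _ (hdet t), mem_circ.2 (by simp)⟩
  have hf : Function.Bijective f := by
    constructor
    · rintro (_ | s) (_ | t) h
      · rfl
      · exfalso
        have h1 := congrArg (fun A : circ F => A.1 0 0) h
        have := hs t
        simp [f] at h1
        field_simp at h1
        exact h2 (by linear_combination -h1)
      · exfalso
        have h1 := congrArg (fun A : circ F => A.1 0 0) h
        have := hs s
        simp [f] at h1
        field_simp at h1
        exact h2 (by linear_combination h1)
      · have h1 := congrArg (fun A : circ F => A.1 0 0) h
        have h3 := congrArg (fun A : circ F => A.1 0 1) h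
        have := hs s
        have := hs t
        simp [f] at h1 h3
        field_simp at h1 h3
        have e : s ^ 2 = t ^ 2 := by
          apply mul_left_cancel₀ h2
          linear_combination - h1
        rw [e] at h3
        congr 1
        refine mul_right_cancel₀ (hs t) ?_
        linear_combination h3
    · rintro ⟨A, hA⟩
      obtain ⟨h1, h3⟩ := mem_circ.1 hA
      have hd := sl2_det A
      rw [h1, ← h3] at hd
      by_cases h : A 0 0 = -1
      · refine ⟨none, Subtype.ext ?_⟩
        have h01 : A 0 1 = 0 := by
          rw [h] at hd
          have : A 0 1 ^ 2 = 0 := by linear_combination hd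
          exact pow_eq_zero_iff two_ne_zero |>.1 this
        apply sl2_ext <;> simp [f, h1, ← h3, h, h01]
      · have h' : 1 + A 0 0 ≠ 0 := fun h0 => h (by linear_combination h0)
        have hss := hs (A 0 1 / (1 + A 0 0))
        have e0 : 1 + (A 0 1 / (1 + A 0 0)) ^ 2 = 2 / (1 + A 0 0) := by
          field_simp
          linear_combination hd
        refine ⟨some (A 0 1 / (1 + A 0 0)), Subtype.ext ?_⟩
        apply sl2_ext <;> simp [f, h1, ← h3, e0] <;> field_simp
        all_goals linear_combination - hd
  rw [← Nat.card_congr (Equiv.ofBijective f hf), Nat.card_eq_fintype_card, Fintype.card_option]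

end Matrices

section Quotient

variable {F : Type} [Field F]

local notation "SLtwo" => Matrix.SpecialLinearGroup (Fin 2) F

/-- The image in `PSL(2, F)` of a subgroup of `SL(2, F)`. -/
def psl2Image (H : Subgroup SLtwo) : Subgroup (PSL2 F) :=
  H.map (QuotientGroup.mk' (Subgroup.center SLtwo))

instance psl2Image_isMulCommutative (H : Subgroup SLtwo) [IsMulCommutative H] :
    IsMulCommutative (psl2Image H) :=
  Subgroup.map_isMulCommutative _ _

lemma mk_mem_psl2Image {H : Subgroup SLtwo} (hH : Subgroup.center SLtwo ≤ H) {A : SLtwo} :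
    (A : PSL2 F) ∈ psl2Image H ↔ A ∈ H := by
  constructor
  · rintro ⟨B, hB, hBA⟩
    have h := QuotientGroup.eq.1 (show (B : PSL2 F) = A from hBA)
    simpa using H.mul_mem hB (hH h)
  · exact fun hA => ⟨A, hA, rfl⟩

lemma two_mul_card_psl2Image (h2 : (2 : F) ≠ 0) {H : Subgroup SLtwo}
    (hH : Subgroup.center SLtwo ≤ H) : 2 * Nat.card (psl2Image H) = Nat.card H := by
  have e : (psl2Image H).comap (QuotientGroup.mk' (Subgroup.center SLtwo)) = H := by
    ext A
    exact mk_mem_psl2Image hH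
  let f := (QuotientGroup.mk' (Subgroup.center SLtwo)).comp H.subtype
  have hr : f.range = psl2Image H := by
    rw [MonoidHom.range_comp, Subgroup.range_subtype]; rfl
  have hk : f.ker = (Subgroup.center SLtwo).subgroupOf H := by
    ext x
    simp [f, MonoidHom.mem_ker, Subgroup.mem_subgroupOf]
  have h := Subgroup.card_mul_index f.ker
  rw [Subgroup.index_ker, hr, hk, Nat.card_congr (Subgroup.subgroupOfEquivOfLe hH).toEquiv,
    card_center h2] at h
  exact h

lemma two_mul_card_psl2 (h2 : (2 : F) ≠ 0) : 2 * Nat.card (PSL2 F) = Nat.card SLtwo := by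
  have h := Subgroup.card_mul_index (Subgroup.center SLtwo)
  rwa [card_center h2] at h

lemma mul_eq_of_conj {A R S : SLtwo} (h : A * R * A⁻¹ = S) (i j : Fin 2) :
    A i 0 * R 0 j + A i 1 * R 1 j = S i 0 * A 0 j + S i 1 * A 1 j := by
  rw [← sl2_mul_apply, ← sl2_mul_apply, ← h]
  simp

lemma sl2_trace_conj {A R S : SLtwo} (h : A * R * A⁻¹ = S) :
    S 0 0 + S 1 1 = R 0 0 + R 1 1 := by
  have h00 := mul_eq_of_conj h 0 0
  have h01 := mul_eq_of_conj h 0 1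
  have h10 := mul_eq_of_conj h 1 0
  have h11 := mul_eq_of_conj h 1 1
  have hd := sl2_det A
  linear_combination (R 0 0 + R 1 1 - S 0 0 - S 1 1) * hd - A 1 1 * h00 + A 1 0 * h01
    + A 0 1 * h10 - A 0 0 * h11

lemma mem_upperTri_of_conj_mem_unip {A R : SLtwo} (hR : R ∈ unip F)
    (hRc : R ∉ Subgroup.center SLtwo) (h : A * R * A⁻¹ ∈ unip F) : A ∈ upperTri F := by
  obtain ⟨h1, h3⟩ := mem_unip.1 hR
  obtain ⟨k1, k3⟩ := mem_unip.1 h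
  have hb : R 0 1 ≠ 0 := fun h0 => hRc (mem_center_sl2_iff.2 ⟨h0, h1, h3⟩)
  have h10 := mul_eq_of_conj (S := A * R * A⁻¹) rfl 1 0
  have h11 := mul_eq_of_conj (S := A * R * A⁻¹) rfl 1 1
  rw [h1, k1] at h10
  rw [k1, ← k3, ← h3] at h11
  rw [mem_upperTri]
  by_contra hz
  have hs : R 0 0 = (A * R * A⁻¹) 0 0 := by
    apply mul_left_cancel₀ hz
    rw [k3]
    linear_combination h10
  rw [← hs] at h11
  exact mul_ne_zero hz hb (by linear_combination h11)

lemma conj_not_mem_unip {A R : SLtwo} (h2 : (2 : F) ≠ 0) (hR : R ∈ circ F)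
    (hRc : R ∉ Subgroup.center SLtwo) : A * R * A⁻¹ ∉ unip F := by
  intro h
  obtain ⟨h1, h3⟩ := mem_circ.1 hR
  obtain ⟨k1, k3⟩ := mem_unip.1 h
  have ht := sl2_trace_conj (A := A) (R := R) rfl
  have hd := sl2_det R
  have hd' := sl2_det (A * R * A⁻¹)
  have ha : (A * R * A⁻¹) 0 0 = R 0 0 := by
    apply mul_left_cancel₀ h2
    rw [← k3, ← h3] at ht
    linear_combination ht
  rw [← k3, k1, ha] at hd'
  rw [← h3, h1] at hd
  have hb : R 0 1 = 0 := by
    have : R 0 1 ^ 2 = 0 := by linear_combination hd - hd'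
    exact pow_eq_zero_iff two_ne_zero |>.1 this
  exact hRc (mem_center_sl2_iff.2 ⟨hb, by rw [h1, hb, neg_zero], h3⟩)

/-- The matrix `!![a, b; b, -a]` inverts the elements of `circ F` by conjugation. -/
lemma conj_circ_eq_inv {P R : SLtwo} (hP : P 1 0 = P 0 1) (hP' : P 1 1 = - P 0 0)
    (hR : R ∈ circ F) : P * R * P⁻¹ = R⁻¹ := by
  obtain ⟨h1, h3⟩ := mem_circ.1 hR
  obtain ⟨k1, k2, k3, k4⟩ := sl2_inv_apply R
  rw [mul_inv_eq_iff_eq_mul]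
  apply sl2_ext <;> simp only [sl2_mul_apply, k1, k2, k3, k4, hP, hP', h1, h3] <;> ring

lemma mem_circ_or_of_conj_mem_circ {A R P : SLtwo} (h2 : (2 : F) ≠ 0) (hP : P 1 0 = P 0 1)
    (hP' : P 1 1 = - P 0 0) (hR : R ∈ circ F) (hRc : R ∉ Subgroup.center SLtwo)
    (h : A * R * A⁻¹ ∈ circ F) : A ∈ circ F ∨ P⁻¹ * A ∈ circ F := by
  obtain ⟨h1, h3⟩ := mem_circ.1 hR
  have hb : R 0 1 ≠ 0 := fun h0 =>
    hRc (mem_center_sl2_iff.2 ⟨h0, by rw [h1, h0, neg_zero], h3⟩)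
  have ht := sl2_trace_conj (A := A) (R := R) rfl
  have h00 := mul_eq_of_conj (S := A * R * A⁻¹) rfl 0 0
  have h01 := mul_eq_of_conj (S := A * R * A⁻¹) rfl 0 1
  have hd := sl2_det R
  have hd' := sl2_det (A * R * A⁻¹)
  generalize A * R * A⁻¹ = S at *
  obtain ⟨k1, k3⟩ := mem_circ.1 h
  rw [← h3, h1] at hd
  rw [← k3, k1] at hd'
  rw [← h3, ← k3] at ht
  rw [h1] at h00
  rw [← h3] at h01
  have ha : S 0 0 = R 0 0 := by
    apply mul_left_cancel₀ h2
    linear_combination ht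
  rw [ha] at hd' h00 h01
  have hbb : S 0 1 ^ 2 = R 0 1 ^ 2 := by linear_combination hd' - hd
  rcases sq_eq_sq_iff_eq_or_eq_neg.1 hbb with e | e
  · left
    rw [e] at h00 h01
    rw [mem_circ]
    constructor <;> apply mul_left_cancel₀ hb
    · linear_combination -h00
    · linear_combination h01
  · right
    rw [e] at h00 h01
    have e1 : A 1 0 = A 0 1 := by
      apply mul_left_cancel₀ hb
      linear_combination h00
    have e2 : A 1 1 = - A 0 0 := by
      apply mul_left_cancel₀ hb
      linear_combination h01
    obtain ⟨k1, k2, k3, k4⟩ := sl2_inv_apply P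
    rw [mem_circ]
    simp only [sl2_mul_apply, k1, k2, k3, k4, e1, e2, hP, hP']
    constructor <;> ring

lemma ne_one_iff_not_mem_center {A : SLtwo} :
    (A : PSL2 F) ≠ 1 ↔ A ∉ Subgroup.center SLtwo := by
  rw [Ne, QuotientGroup.eq_one_iff]

end Quotient

section Character

variable {F : Type} [Field F] [Fintype F]

local notation "SLtwo" => Matrix.SpecialLinearGroup (Fin 2) F

lemma two_ne_zero_of_odd_card (hF : Fintype.card F % 2 = 1) : (2 : F) ≠ 0 :=
  Ring.two_ne_zero fun h => by
    have := FiniteField.even_card_of_char_two h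
    omega

lemma exists_sq_add_sq_eq (hF : Fintype.card F % 2 = 1) (c : F) : ∃ a b : F, a ^ 2 + b ^ 2 = c := by
  obtain ⟨a, b, hab⟩ := FiniteField.exists_root_sum_quadratic (R := F)
    (f := Polynomial.X ^ 2) (g := Polynomial.X ^ 2 - Polynomial.C c)
    (Polynomial.degree_X_pow 2) (Polynomial.degree_X_pow_sub_C (by decide) _) hF
  refine ⟨a, b, ?_⟩
  simp only [Polynomial.eval_sub, Polynomial.eval_pow, Polynomial.eval_X, Polynomial.eval_C] at hab
  linear_combination hab

lemma sq_ne_neg_one (hF : Fintype.card F % 4 = 3) (t : F) : t ^ 2 ≠ -1 := fun h =>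
  FiniteField.isSquare_neg_one_iff.1 ⟨t, by rw [← h, sq]⟩ hF

lemma exists_conj_inv (hF : Fintype.card F % 2 = 1) :
    ∃ P : SLtwo, P 1 0 = P 0 1 ∧ P 1 1 = - P 0 0 := by
  obtain ⟨a, b, h⟩ := exists_sq_add_sq_eq hF (-1 : F)
  exact ⟨sl2Mk a b b (-a) (by linear_combination -h), by simp⟩

lemma card_psl2Image_circ (hF : Fintype.card F % 4 = 3) :
    2 * Nat.card (psl2Image (circ F)) = Fintype.card F + 1 := by
  have h2 := two_ne_zero_of_odd_card (F := F) (by omega)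
  rw [two_mul_card_psl2Image h2 center_le_circ, card_circ h2 fun t h =>
    sq_ne_neg_one hF t (by linear_combination h)]

lemma card_psl2Image_unip (hF : Fintype.card F % 2 = 1) :
    Nat.card (psl2Image (unip F)) = Fintype.card F := by
  have h2 := two_ne_zero_of_odd_card hF
  have := two_mul_card_psl2Image h2 (center_le_unip (F := F))
  rw [card_unip h2] at this
  omega

/-- The characters of degree `(q - 1) / 2` of `PSL(2, q)`, `q ≡ 3 (mod 4)`, away from the
unipotent elements. -/
lemma exists_linear_and_character_eq_zero (hF : Fintype.card F % 4 = 3) (V : FDRep ℂ (PSL2 F))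
    [CategoryTheory.Simple V] (hd : 2 * Module.finrank ℂ V + 1 = Fintype.card F) :
    (∃ l : psl2Image (circ F) →* ℂ, (∀ k, l k * l k = 1) ∧
      ∀ k : psl2Image (circ F), k ≠ 1 → V.character k = - l k) ∧
    ∀ g : PSL2 F, (∀ x, x⁻¹ * g * x ∉ psl2Image (circ F)) →
      (∀ x, x⁻¹ * g * x ∉ psl2Image (unip F)) → V.character g = 0 := by
  let _ : Fintype (PSL2 F) := Fintype.ofFinite _
  have h2 := two_ne_zero_of_odd_card (F := F) (by omega)
  obtain ⟨P, hP, hP'⟩ := exists_conj_inv (F := F) (by omega)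
  have hK := card_psl2Image_circ hF
  have hU := card_psl2Image_unip (F := F) (by omega)
  set d := Module.finrank ℂ V with hdd
  set K := psl2Image (circ F) with hKdef
  set U := psl2Image (unip F) with hUdef
  have hG : Fintype.card (PSL2 F) = 2 * d * (d + 1) * (2 * d + 1) := by
    have := two_mul_card_psl2 h2
    rw [card_sl2, ← hd, Nat.add_sub_cancel, Nat.card_eq_fintype_card] at this
    apply Nat.eq_of_mul_eq_mul_left two_pos
    rw [this]; ring
  have hB : Nat.card (psl2Image (upperTri F)) = d * (2 * d + 1) := by
    have := two_mul_card_psl2Image h2 (center_le_upperTri (F := F))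
    rw [card_upperTri, ← hd, Nat.add_sub_cancel] at this
    apply Nat.eq_of_mul_eq_mul_left two_pos
    rw [this]; ring
  have hfilter : ∀ H : Subgroup (PSL2 F), (Finset.univ.filter (· ∈ H)).card = Nat.card H :=
    fun H => by
      rw [Nat.card_eq_fintype_card, Fintype.card_subtype]
  obtain ⟨hKs, hvan⟩ := sum_normSq_le_and_character_eq_zero V.ρ (sum_normSq_character V) K U
    (Finset.univ.filter (· ∈ K) ∪ (Finset.univ.filter (· ∈ K)).image ((P : PSL2 F) * ·))
    (Finset.univ.filter (· ∈ psl2Image (upperTri F)))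
    (by
      intro x k hk hk1 hx
      induction x using QuotientGroup.induction_on with | _ A
      induction k using QuotientGroup.induction_on with | _ R
      rw [ne_one_iff_not_mem_center] at hk1
      rw [mk_mem_psl2Image center_le_circ] at hk
      have hx' : A * R * A⁻¹ ∈ circ F := (mk_mem_psl2Image center_le_circ).1 hx
      simp only [Finset.mem_union, Finset.mem_filter, Finset.mem_univ, true_and, Finset.mem_image]
      rcases mem_circ_or_of_conj_mem_circ h2 hP hP' hk hk1 hx' with h | h
      · exact Or.inl ((mk_mem_psl2Image center_le_circ).2 h)
      · exact Or.inr ⟨_, (mk_mem_psl2Image center_le_circ).2 h, by simp⟩)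
    (by
      intro x k hk hk1 hx
      induction x using QuotientGroup.induction_on with | _ A
      induction k using QuotientGroup.induction_on with | _ R
      rw [ne_one_iff_not_mem_center] at hk1
      rw [mk_mem_psl2Image center_le_unip] at hk
      have hx' : A * R * A⁻¹ ∈ unip F := (mk_mem_psl2Image center_le_unip).1 hx
      simp only [Finset.mem_filter, Finset.mem_univ, true_and]
      exact (mk_mem_psl2Image center_le_upperTri).2 (mem_upperTri_of_conj_mem_unip hk hk1 hx'))
    (by
      intro x k hk hk1 hx
      induction x using QuotientGroup.induction_on with | _ A
      induction k using QuotientGroup.induction_on with | _ R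
      rw [ne_one_iff_not_mem_center] at hk1
      rw [mk_mem_psl2Image center_le_circ] at hk
      have hx' : A * R * A⁻¹ ∈ unip F := (mk_mem_psl2Image center_le_unip).1 hx
      exact conj_not_mem_unip h2 hk hk1 hx')
    d rfl (by omega) hG (by omega) (by omega)
    (by
      refine (Finset.card_union_le _ _).trans ?_
      have := Finset.card_image_le (s := Finset.univ.filter (· ∈ K)) (f := ((P : PSL2 F) * ·))
      rw [hfilter] at this ⊢
      omega)
    (by rw [hfilter, hB])
  refine ⟨?_, hvan⟩
  obtain ⟨l, hl⟩ := exists_linear_of_sum_normSq_le V.ρ K (by omega) hKs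
  refine ⟨l, fun k => ?_, hl⟩
  by_cases hk : k = 1
  · simp [hk]
  have hconj : (P : PSL2 F) * k * (P : PSL2 F)⁻¹ = (k : PSL2 F)⁻¹ := by
    obtain ⟨k, R, hR, rfl⟩ := k
    exact congrArg (QuotientGroup.mk (s := Subgroup.center SLtwo)) (conj_circ_eq_inv hP hP' hR)
  have h1 := hl k hk
  have h3 := hl k⁻¹ (inv_ne_one.2 hk)
  have h4 : l k⁻¹ = l k := by
    rw [← neg_inj, ← h1, ← h3, Subgroup.coe_inv, ← hconj, Representation.char_conj]
  calc l k * l k = l k * l k⁻¹ := by rw [h4]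
    _ = 1 := by rw [← map_mul, mul_inv_cancel, map_one]

/-- The square of an element of the circle group to which every involution is conjugate. -/
lemma exists_conj_eq_sq (hF : Fintype.card F % 8 = 7) :
    ∃ s : psl2Image (circ F), ∀ g : PSL2 F, g ^ 2 = 1 → g ≠ 1 →
      ∃ x, x⁻¹ * g * x = ((s * s : psl2Image (circ F)) : PSL2 F) := by
  have h2 := two_ne_zero_of_odd_card (F := F) (by omega)
  obtain ⟨t, ht⟩ := FiniteField.isSquare_two_iff (F := F).2 (by omega)
  have ht0 : t ≠ 0 := fun h => h2 (by rw [ht, h, mul_zero])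
  let S : SLtwo := sl2Mk t⁻¹ (-t⁻¹) t⁻¹ t⁻¹ (by field_simp; linear_combination ht)
  refine ⟨⟨(S : PSL2 F), (mk_mem_psl2Image center_le_circ).2 (mem_circ.2 (by simp [S]))⟩, ?_⟩
  intro g hg hg1
  induction g using QuotientGroup.induction_on with | _ A
  rw [ne_one_iff_not_mem_center] at hg1
  have hsq : A * A ∈ Subgroup.center SLtwo := by
    rw [← QuotientGroup.eq_one_iff, QuotientGroup.mk_mul, ← sq, hg]
  have hdet := sl2_det A
  rw [mem_center_sl2_iff] at hsq hg1
  simp only [sl2_mul_apply] at hsq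
  obtain ⟨e1, e2, e3⟩ := hsq
  have htr : A 1 1 = - A 0 0 := by
    by_contra hne
    have hne' : A 0 0 + A 1 1 ≠ 0 := fun h => hne (by linear_combination h)
    refine hg1 ⟨?_, ?_, ?_⟩ <;> apply mul_left_cancel₀ hne'
    · linear_combination e1
    · linear_combination e2
    · linear_combination e3
  rw [htr] at hdet
  have hc : A 1 0 ≠ 0 := fun h => sq_ne_neg_one (F := F) (by omega) (A 0 0) (by
    rw [h] at hdet; linear_combination -hdet)
  obtain ⟨u, y, huy⟩ := exists_sq_add_sq_eq (F := F) (by omega) (A 1 0)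
  have hx : ∃ x, A 1 0 * x = u + A 0 0 * y := ⟨(u + A 0 0 * y) / A 1 0, by field_simp⟩
  obtain ⟨x, hx⟩ := hx
  let X : SLtwo := sl2Mk x (A 0 0 * x + A 0 1 * y) y (A 1 0 * x + A 1 1 * y) (by
    apply mul_left_cancel₀ hc
    rw [htr]
    linear_combination (A 1 0 * x - A 0 0 * y + u) * hx + huy + y ^ 2 * hdet)
  refine ⟨(X : PSL2 F), ?_⟩
  have hXJ : A * X = X * (S * S) := by
    have hs : t⁻¹ * t⁻¹ * 2 = 1 := by rw [ht]; field_simp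
    apply sl2_ext <;> simp only [sl2_mul_apply, X, S, sl2Mk_apply, htr]
    · linear_combination -(A 0 0 * x + A 0 1 * y) * hs
    · linear_combination x * hs - x * hdet
    · linear_combination -(A 1 0 * x - A 0 0 * y) * hs
    · linear_combination y * hs - y * hdet
  have : X⁻¹ * A * X = S * S := by rw [mul_assoc, hXJ, inv_mul_cancel_left]
  exact congrArg (QuotientGroup.mk (s := Subgroup.center SLtwo)) this

lemma character_involution (hF : Fintype.card F % 8 = 7) (V : FDRep ℂ (PSL2 F))
    [CategoryTheory.Simple V] (hd : 2 * Module.finrank ℂ V + 1 = Fintype.card F)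
    {g : PSL2 F} (hg : g ^ 2 = 1) (hg1 : g ≠ 1) : V.character g = -1 := by
  obtain ⟨⟨l, hl, hχ⟩, -⟩ := exists_linear_and_character_eq_zero (by omega) V hd
  obtain ⟨s, hs⟩ := exists_conj_eq_sq hF
  obtain ⟨x, hx⟩ := hs g hg hg1
  have hss : s * s ≠ 1 := by
    intro h
    rw [h, Subgroup.coe_one] at hx
    refine hg1 ?_
    have : g = x * (x⁻¹ * g * x) * x⁻¹ := by group
    rw [this, hx]; group
  have h := hχ _ hss
  rw [map_mul, hl, ← hx] at h
  have hc := V.char_conj g x⁻¹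
  rw [inv_inv] at hc
  rw [← hc, h]

/-- A subgroup of prime order not dividing the index of `K` is conjugate to a subgroup of `K`. -/
lemma exists_conj_mem_of_not_dvd_index {G : Type*} [Group G] (H K : Subgroup G) {p : ℕ}
    (hp : p.Prime) (hH : Nat.card H = p) (hK : ¬ p ∣ K.index) :
    ∃ x : G, ∀ h ∈ H, x⁻¹ * h * x ∈ K := by
  have _ : Fact p.Prime := ⟨hp⟩
  have hpg : IsPGroup p H := IsPGroup.of_card (n := 1) (by rw [hH, pow_one])
  obtain ⟨y, hy⟩ := hpg.nonempty_fixed_point_of_prime_not_dvd_card (G ⧸ K) hK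
  induction y using QuotientGroup.induction_on with | _ x
  refine ⟨x, fun h hh => ?_⟩
  have := QuotientGroup.eq.1 (hy ⟨h, hh⟩)
  rw [← K.inv_mem_iff]
  convert this using 1
  simp [mul_assoc]

lemma character_of_dvd_add_one (hF : Fintype.card F % 4 = 3) (V : FDRep ℂ (PSL2 F))
    [CategoryTheory.Simple V] (hd : 2 * Module.finrank ℂ V + 1 = Fintype.card F)
    {p : ℕ} (hp : p.Prime) (hp2 : p ≠ 2) (hdvd : p ∣ Fintype.card F + 1)
    (H : Subgroup (PSL2 F)) (hH : Nat.card H = p) {g : PSL2 F} (hg : g ∈ H) (hg1 : g ≠ 1) :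
    V.character g = -1 := by
  obtain ⟨⟨l, hl, hχ⟩, -⟩ := exists_linear_and_character_eq_zero hF V hd
  have h2 := two_ne_zero_of_odd_card (F := F) (by omega)
  have hidx : (psl2Image (circ F)).index = (Fintype.card F - 1) * Fintype.card F := by
    have e1 := Subgroup.card_mul_index (psl2Image (circ F))
    have e2 := card_psl2Image_circ hF
    have e3 := two_mul_card_psl2 h2
    rw [card_sl2, ← e1, ← mul_assoc, e2, mul_comm] at e3
    exact Nat.eq_of_mul_eq_mul_right (Nat.succ_pos _) e3
  have hp2' : ¬ p ∣ 2 := fun h => hp2 ((Nat.prime_dvd_prime_iff_eq hp Nat.prime_two).1 h)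
  obtain ⟨x, hx⟩ := exists_conj_mem_of_not_dvd_index H (psl2Image (circ F)) hp hH (by
    rw [hidx, hp.dvd_mul]
    rintro (h | h)
    · refine hp2' ?_
      have := Nat.dvd_sub hdvd h
      rwa [show Fintype.card F + 1 - (Fintype.card F - 1) = 2 by omega] at this
    · exact hp.one_lt.ne' (Nat.dvd_one.1 ((Nat.dvd_add_right h).1 hdvd)))
  set k : psl2Image (circ F) := ⟨x⁻¹ * g * x, hx g hg⟩ with hk
  have hgp : g ^ p = 1 := by
    have := pow_card_eq_one' (x := (⟨g, hg⟩ : H))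
    rw [hH] at this
    exact congrArg Subtype.val this
  have hkp : k ^ p = 1 := by
    apply Subtype.ext
    have := conj_pow (a := x⁻¹) (b := g) (i := p)
    rw [inv_inv, hgp] at this
    simp [hk, this]
  have hk1 : k ≠ 1 := by
    intro h
    have h' : x⁻¹ * g * x = 1 := congrArg Subtype.val h
    refine hg1 ?_
    have : g = x * (x⁻¹ * g * x) * x⁻¹ := by group
    rw [this, h']; group
  have hlk : l k = 1 := by
    obtain ⟨n, hn⟩ := hp.odd_of_ne_two hp2
    have h : l k ^ p = 1 := by rw [← map_pow, hkp, map_one]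
    rw [hn, pow_succ, pow_mul, sq, hl, one_pow, one_mul] at h
    exact h
  have h := hχ k hk1
  have hc := V.char_conj g x⁻¹
  rw [inv_inv] at hc
  rw [← hc, ← hlk]
  exact h

lemma character_of_dvd_sub_one (hF : Fintype.card F % 4 = 3) (V : FDRep ℂ (PSL2 F))
    [CategoryTheory.Simple V] (hd : 2 * Module.finrank ℂ V + 1 = Fintype.card F)
    {p : ℕ} (hp : p.Prime) (hp2 : p ≠ 2) (hdvd : p ∣ Fintype.card F - 1)
    (H : Subgroup (PSL2 F)) (hH : Nat.card H = p) {g : PSL2 F} (hg : g ∈ H) (hg1 : g ≠ 1) :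
    V.character g = 0 := by
  obtain ⟨-, hv⟩ := exists_linear_and_character_eq_zero hF V hd
  have hp2' : ¬ p ∣ 2 := fun h => hp2 ((Nat.prime_dvd_prime_iff_eq hp Nat.prime_two).1 h)
  have hord : ∀ x, orderOf (x⁻¹ * g * x) = p := by
    intro x
    have _ : Fact p.Prime := ⟨hp⟩
    have hgp : g ^ p = 1 := by
      have := pow_card_eq_one' (x := (⟨g, hg⟩ : H))
      rw [hH] at this
      exact congrArg Subtype.val this
    have := orderOf_injective (MulAut.conj x⁻¹).toMonoidHom (MulAut.conj x⁻¹).injective g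
    rw [orderOf_eq_prime hgp hg1] at this
    simpa using this
  have hmem : ∀ (L : Subgroup (PSL2 F)) (x), x⁻¹ * g * x ∈ L → p ∣ Nat.card L := fun L x hx => by
    rw [← hord x]
    exact Subgroup.orderOf_dvd_natCard L hx
  refine hv g (fun x hx => hp2' ?_) fun x hx => ?_
  · have h1 := (hmem _ x hx).mul_left 2
    rw [card_psl2Image_circ hF] at h1
    have := Nat.dvd_sub h1 hdvd
    rwa [show Fintype.card F + 1 - (Fintype.card F - 1) = 2 by omega] at this
  · have h1 := hmem _ x hx
    rw [card_psl2Image_unip (by omega)] at h1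
    have := Nat.dvd_sub h1 hdvd
    rw [show Fintype.card F - (Fintype.card F - 1) = 1 by omega] at this
    exact hp.one_lt.ne' (Nat.dvd_one.1 this)

end Character

lemma restMult_of_const {G : Type} [Group G] [Finite G] (H : Subgroup G) (θ : H →* ℂˣ)
    (hθ : θ ≠ 1) (χ : G → ℂ) (c : ℂ) (hc : ∀ h ∈ H, h ≠ 1 → χ h = c) :
    restMult H θ χ = (χ 1 - c) / Nat.card H := by
  let _ : Fintype H := Fintype.ofFinite H
  have h0 : ∑ h : H, ((θ h : ℂ))⁻¹ = 0 := by
    have hne : (Units.coeHom ℂ).comp θ⁻¹ ≠ 1 := fun h => hθ (by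
      ext x
      have := DFunLike.congr_fun h x
      simpa using this)
    simpa using sum_hom_units_eq_zero _ hne
  have h1 : ∀ h : H, χ h * ((θ h : ℂ))⁻¹
      = c * ((θ h : ℂ))⁻¹ + if h = 1 then χ 1 - c else 0 := by
    intro h
    split_ifs with hh
    · subst hh; simp
    · rw [hc h h.2 fun e => hh (Subtype.ext e), add_zero]
  rw [restMult, Finset.sum_congr rfl fun h _ => h1 h, Finset.sum_add_distrib, ← Finset.mul_sum, h0]
  simp [div_eq_inv_mul]

lemma pow_ne_one_of_injective {G M : Type*} [Group G] [CommGroup M] {p : ℕ} (hp : p.Prime)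
    (hG : Nat.card G = p) (θ : G →* M) (hθ : Function.Injective θ) {k : ℕ} (hk0 : 0 < k)
    (hk : k < p) : θ ^ k ≠ 1 := by
  intro h
  have _ : Fact p.Prime := ⟨hp⟩
  have _ : Finite G := Nat.finite_of_card_ne_zero (by rw [hG]; exact hp.ne_zero)
  obtain ⟨g, hg⟩ := exists_prime_orderOf_dvd_card' (G := G) p (by rw [hG])
  have h1 : g ^ k = 1 := hθ (by rw [map_pow, map_one]; exact DFunLike.congr_fun h g)
  have := Nat.le_of_dvd hk0 (hg ▸ orderOf_dvd_of_pow_eq_one h1)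
  omega

theorem ramification_module_q7mod8
    (q : ℕ) (hq : IsPrimePow q) (hgcd : Nat.Coprime q 42)
    (hq7 : q % 7 = 1 ∨ q % 7 = 6)
    (F : Type) [Field F] [Fintype F] (hF : Fintype.card F = q)
    (H2 H3 H7 : Subgroup (PSL2 F))
    (hH2 : Nat.card H2 = 2) (hH3 : Nat.card H3 = 3) (hH7 : Nat.card H7 = 7)
    (θ2 : H2 →* ℂˣ) (θ3 : H3 →* ℂˣ) (θ7 : H7 →* ℂˣ)
    (hθ2 : Function.Injective θ2) (hθ3 : Function.Injective θ3)
    (hθ7 : Function.Injective θ7)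
    (hq8 : q % 8 = 7)
    (χ : PSL2 F → ℂ) (hχ : IsIrrCharacter (PSL2 F) χ) (hdeg : χ 1 = ((q : ℂ) - 1) / 2)
    :
    ramMult H2 H3 H7 θ2 θ3 θ7 χ = (baseMult q : ℂ) / 2 := by
  subst hF
  obtain ⟨V, hV, rfl⟩ := hχ
  obtain ⟨d, hd⟩ : ∃ d, Module.finrank ℂ V = d := ⟨_, rfl⟩
  rw [FDRep.char_one, hd] at hdeg
  have hcard : Fintype.card F = 2 * d + 1 := by
    have : (Fintype.card F : ℂ) = 2 * d + 1 := by rw [hdeg]; ring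
    exact_mod_cast this
  have hdim : 2 * Module.finrank ℂ V + 1 = Fintype.card F := by rw [hd, hcard]
  have hq3 : Fintype.card F % 3 = 1 ∨ Fintype.card F % 3 = 2 := by
    have : ¬ 3 ∣ Fintype.card F := fun h => by
      have := Nat.dvd_gcd h (show 3 ∣ 42 by norm_num)
      rw [hgcd] at this
      omega
    omega
  have r2 := restMult_of_const H2 θ2
    (by simpa using pow_ne_one_of_injective Nat.prime_two hH2 θ2 hθ2 one_pos one_lt_two)
    V.character (-1) fun h hh h1 => character_involution hq8 V hdim
      (by
        have := pow_card_eq_one' (x := (⟨h, hh⟩ : H2))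
        rw [hH2] at this
        exact congrArg Subtype.val this) h1
  have r3 : ∀ k, 0 < k → k < 3 → restMult H3 (θ3 ^ k) V.character
      = (d - if Fintype.card F % 3 = 1 then 0 else -1) / 3 := by
    intro k hk0 hk
    rw [restMult_of_const H3 (θ3 ^ k) (pow_ne_one_of_injective Nat.prime_three hH3 θ3 hθ3 hk0 hk)
      V.character (if Fintype.card F % 3 = 1 then 0 else -1), hH3, FDRep.char_one, hd]
    · norm_num
    · intro h hh h1
      split_ifs with hc
      · exact character_of_dvd_sub_one (by omega) V hdim Nat.prime_three (by norm_num) (by omega)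
          H3 hH3 hh h1
      · exact character_of_dvd_add_one (by omega) V hdim Nat.prime_three (by norm_num) (by omega)
          H3 hH3 hh h1
  have r7 : ∀ k, 0 < k → k < 7 → restMult H7 (θ7 ^ k) V.character
      = (d - if Fintype.card F % 7 = 1 then 0 else -1) / 7 := by
    intro k hk0 hk
    rw [restMult_of_const H7 (θ7 ^ k)
      (pow_ne_one_of_injective (by norm_num) hH7 θ7 hθ7 hk0 hk)
      V.character (if Fintype.card F % 7 = 1 then 0 else -1), hH7, FDRep.char_one, hd]
    · norm_num
    · intro h hh h1
      split_ifs with hc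
      · exact character_of_dvd_sub_one (by omega) V hdim (by norm_num) (by norm_num) (by omega)
          H7 hH7 hh h1
      · exact character_of_dvd_add_one (by omega) V hdim (by norm_num) (by norm_num) (by omega)
          H7 hH7 hh h1
  have r31 := r3 1 one_pos (by norm_num)
  rw [pow_one] at r31
  have r7s : ∑ k ∈ Finset.Icc (1 : ℕ) 6, (k : ℂ) * restMult H7 (θ7 ^ k) V.character
      = 21 * ((d - if Fintype.card F % 7 = 1 then 0 else -1) / 7) := by
    rw [Finset.sum_congr rfl fun k hk => by
      rw [r7 k (Finset.mem_Icc.1 hk).1 (by have := (Finset.mem_Icc.1 hk).2; omega)],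
      ← Finset.sum_mul]
    congr 1
    norm_num [Finset.sum_Icc_succ_top]
  rw [ramMult, r2, r31, r3 2 two_pos (by norm_num), r7s, hH2, FDRep.char_one, hd]
  have hb : 84 * baseMult (Fintype.card F) = 21 * (2 * d + 2)
      + 28 * (2 * d + 1 - if Fintype.card F % 3 = 1 then 1 else -1)
      + 36 * (2 * d + 1 - if Fintype.card F % 7 = 1 then 1 else -1) := by
    rw [baseMult, if_neg (by omega)]
    split_ifs <;> omega
  have hb' : (baseMult (Fintype.card F) : ℂ) = (21 * (2 * d + 2)
      + 28 * (2 * d + 1 - if Fintype.card F % 3 = 1 then 1 else -1)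
      + 36 * (2 * d + 1 - if Fintype.card F % 7 = 1 then 1 else -1)) / 84 := by
    rw [eq_div_iff (by norm_num), mul_comm]
    exact_mod_cast congrArg (Int.cast (R := ℂ)) hb
  rw [hb']
  split_ifs <;> push_cast <;> ring
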